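/- For m = 1 there is an open and dense subset U of ℝ³ such that for every parameter triple (α, β, ρ) ∈ U, the solution set of the bifurcation system (B) for the (1:1) resonance is a nonempty finite set consisting entirely of simple solutions. -/

import Mathlib

open Real Set

/-- Bessel function of integer order `n`. -/
noncomputable def besselJ (n : ℤ) (x : ℝ) : ℝ :=
  (1 / (2 * π)) * ∫ t in (0:ℝ)..(2 * π), Real.cos (n * t - x * Real.sin t)

/-- Derivative of the Bessel function with respect to its argument. -/
noncomputable def besselJd (n : ℤ) (x : ℝ) : ℝ := deriv (besselJ n) x

/-- The Fourier coefficient `A_m(e)`. -/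
noncomputable def coefA (m : ℕ) (e : ℝ) : ℝ :=
  (4 / ((m:ℝ) ^ 2 * e ^ 2)) *
    (2 * m * e * (1 - e ^ 2) * besselJd m (m * e) - (2 - e ^ 2) * besselJ m (m * e))

/-- The Fourier coefficient `B_m(e)`. -/
noncomputable def coefB (m : ℕ) (e : ℝ) : ℝ :=
  -(8 / ((m:ℝ) ^ 2 * e ^ 2)) * Real.sqrt (1 - e ^ 2) *
    (e * besselJd m (m * e) - m * (1 - e ^ 2) * besselJ m (m * e))

/-- `𝓔 = √(α²+β²+2αβ sin ρ)`. -/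
noncomputable def calE (α β ρ : ℝ) : ℝ := Real.sqrt (α ^ 2 + β ^ 2 + 2 * α * β * Real.sin ρ)

/-- `𝓕 = √(α²+β²−2αβ sin ρ)`. -/
noncomputable def calF (α β ρ : ℝ) : ℝ := Real.sqrt (α ^ 2 + β ^ 2 - 2 * α * β * Real.sin ρ)

/-- First equation of the bifurcation system (B): `𝓕(A_m+B_m)cos(2g+mℓ+τ)`. -/
noncomputable def bifF1 (m : ℕ) (α β ρ τ : ℝ) (e ℓ g : ℝ) : ℝ :=
  calF α β ρ * (coefA m e + coefB m e) * Real.cos (2 * g + m * ℓ + τ)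

/-- Second equation of the bifurcation system (B): `𝓔(A_m−B_m)cos(2g−mℓ+σ)`. -/
noncomputable def bifF2 (m : ℕ) (α β ρ σ : ℝ) (e ℓ g : ℝ) : ℝ :=
  calE α β ρ * (coefA m e - coefB m e) * Real.cos (2 * g - m * ℓ + σ)

/-- Third equation of the bifurcation system (B):
`(A_m'+B_m')𝓕 sin(2g+mℓ+τ) + (A_m'−B_m')𝓔 sin(2g−mℓ+σ)`. -/
noncomputable def bifF3 (m : ℕ) (α β ρ σ τ : ℝ) (e ℓ g : ℝ) : ℝ :=
  (deriv (coefA m) e + deriv (coefB m) e) * calF α β ρ * Real.sin (2 * g + m * ℓ + τ) +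
  (deriv (coefA m) e - deriv (coefB m) e) * calE α β ρ * Real.sin (2 * g - m * ℓ + σ)

/-- The solution set of the bifurcation system (B) for the `(m:1)` resonance, in the
unknowns `(e, ℓ, g) ∈ (0,1) × [0,2π) × [0,2π)`. -/
noncomputable def bifSolSet (m : ℕ) (α β ρ σ τ : ℝ) : Set (ℝ × ℝ × ℝ) :=
  {p | p.1 ∈ Set.Ioo (0:ℝ) 1 ∧ p.2.1 ∈ Set.Ico (0:ℝ) (2 * π) ∧
       p.2.2 ∈ Set.Ico (0:ℝ) (2 * π) ∧
       bifF1 m α β ρ τ p.1 p.2.1 p.2.2 = 0 ∧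
       bifF2 m α β ρ σ p.1 p.2.1 p.2.2 = 0 ∧
       bifF3 m α β ρ σ τ p.1 p.2.1 p.2.2 = 0}

/-- Jacobian determinant of the three left-hand sides of system (B) with respect to
`(e, ℓ, g)`; a solution is simple when this is nonzero. -/
noncomputable def bifJac (m : ℕ) (α β ρ σ τ : ℝ) (e ℓ g : ℝ) : ℝ :=
  Matrix.det
    !![deriv (fun x => bifF1 m α β ρ τ x ℓ g) e,
       deriv (fun x => bifF1 m α β ρ τ e x g) ℓ,
       deriv (fun x => bifF1 m α β ρ τ e ℓ x) g;
       deriv (fun x => bifF2 m α β ρ σ x ℓ g) e,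
       deriv (fun x => bifF2 m α β ρ σ e x g) ℓ,
       deriv (fun x => bifF2 m α β ρ σ e ℓ x) g;
       deriv (fun x => bifF3 m α β ρ σ τ x ℓ g) e,
       deriv (fun x => bifF3 m α β ρ σ τ e x g) ℓ,
       deriv (fun x => bifF3 m α β ρ σ τ e ℓ x) g]


/-- Complex parametric integral. -/
noncomputable def cG (φ : ℝ → ℝ) (z : ℂ) : ℂ :=
  ∫ t in (0:ℝ)..(2 * π), (φ t : ℂ) * Complex.cos (z * (Real.sin t : ℂ))

theorem cG_hasDerivAt (φ : ℝ → ℝ) (hφ : Continuous φ) (z : ℂ) :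
    HasDerivAt (cG φ) (∫ t in (0:ℝ)..(2 * π),
      (φ t : ℂ) * (-Complex.sin (z * (Real.sin t : ℂ)) * (Real.sin t : ℂ))) z := by
  set F' : ℂ → ℝ → ℂ := fun z t =>
    (φ t : ℂ) * (-Complex.sin (z * (Real.sin t : ℂ)) * (Real.sin t : ℂ)) with hF'
  have hc' : Continuous (fun p : ℂ × ℝ => F' p.1 p.2) := by
    simp only [hF']; fun_prop
  obtain ⟨C, hC⟩ := ((isCompact_closedBall z 1).prod (isCompact_uIcc (a := (0:ℝ)) (b := 2 * π))).exists_bound_of_continuousOn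
    hc'.continuousOn
  refine (intervalIntegral.hasDerivAt_integral_of_dominated_loc_of_deriv_le
    (F := fun z t => (φ t : ℂ) * Complex.cos (z * (Real.sin t : ℂ))) (F' := F') (bound := fun _ => C)
    (Metric.closedBall_mem_nhds z one_pos) ?_ ?_ ?_ ?_ ?_ ?_).2
  · refine Filter.Eventually.of_forall fun x => Continuous.aestronglyMeasurable ?_
    fun_prop
  · apply Continuous.intervalIntegrable; fun_prop
  · apply Continuous.aestronglyMeasurable; simp only [hF']; fun_prop
  · refine Filter.Eventually.of_forall fun t ht x hx => hC (x, t) ⟨hx, uIoc_subset_uIcc ht⟩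
  · exact intervalIntegrable_const
  · refine Filter.Eventually.of_forall fun t ht x hx => ?_
    simp only [hF']
    have h1 : HasDerivAt (fun x : ℂ => x * (Real.sin t : ℂ)) (Real.sin t : ℂ) x := by
      simpa using (hasDerivAt_id x).mul_const (Real.sin t : ℂ)
    exact (h1.ccos).const_mul _

/-- The basic moments. -/
noncomputable def MM (n : ℕ) (x : ℝ) : ℝ :=
  (1 / (2 * π)) * ∫ t in (0:ℝ)..(2 * π), Real.cos t ^ (2 * n) * Real.cos (x * Real.sin t)

theorem cG_real (φ : ℝ → ℝ) (x : ℝ) :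
    cG φ x = ((∫ t in (0:ℝ)..(2 * π), φ t * Real.cos (x * Real.sin t) : ℝ) : ℂ) := by
  rw [cG, ← intervalIntegral.integral_ofReal]
  congr 1; ext t; push_cast; rfl

theorem MM_eq (n : ℕ) :
    MM n = fun x : ℝ => (1 / (2 * π)) * (cG (fun t => Real.cos t ^ (2 * n)) x).re := by
  ext x; rw [cG_real]; simp [MM]

theorem MM_analytic (n : ℕ) (x : ℝ) : AnalyticAt ℝ (MM n) x := by
  rw [MM_eq]
  have h : Differentiable ℂ (cG (fun t => Real.cos t ^ (2 * n))) := fun z =>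
    (cG_hasDerivAt _ (by fun_prop) z).differentiableAt
  exact analyticAt_const.mul (h.analyticAt (x : ℂ)).re_ofReal

theorem MM_ibp (n : ℕ) (x : ℝ) :
    (2 * n + 1) * ∫ t in (0:ℝ)..(2 * π), Real.cos t ^ (2 * n) *
      (Real.sin (x * Real.sin t) * Real.sin t)
    = x * ∫ t in (0:ℝ)..(2 * π), Real.cos t ^ (2 * (n + 1)) * Real.cos (x * Real.sin t) := by
  have h := intervalIntegral.integral_eq_sub_of_hasDerivAt (a := 0) (b := 2 * π)
    (f := fun t => Real.cos t ^ (2 * n + 1) * Real.sin (x * Real.sin t))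
    (f' := fun t => x * (Real.cos t ^ (2 * (n + 1)) * Real.cos (x * Real.sin t)) -
      (2 * n + 1) * (Real.cos t ^ (2 * n) * (Real.sin (x * Real.sin t) * Real.sin t)))
    (fun t _ => by
      have h1 := (Real.hasDerivAt_cos t).pow (2 * n + 1)
      have h2 := ((Real.hasDerivAt_sin t).const_mul x).sin
      refine (h1.mul h2).congr_deriv ?_
      push_cast
      rw [Pi.pow_apply]
      ring)
    (by apply Continuous.intervalIntegrable; fun_prop)
  rw [intervalIntegral.integral_sub (by apply Continuous.intervalIntegrable; fun_prop)
    (by apply Continuous.intervalIntegrable; fun_prop),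
    intervalIntegral.integral_const_mul, intervalIntegral.integral_const_mul] at h
  simp at h
  linarith

theorem MM_hasDerivAt (n : ℕ) (x : ℝ) :
    HasDerivAt (MM n) (-(x / (2 * n + 1)) * MM (n + 1) x) x := by
  have h := (cG_hasDerivAt (fun t => Real.cos t ^ (2 * n)) (by fun_prop) (x : ℂ)).real_of_complex
  have h2 := h.const_mul (1 / (2 * π))
  rw [MM_eq n]
  refine h2.congr_deriv ?_
  have h3 : (∫ t in (0:ℝ)..(2 * π), ((Real.cos t ^ (2 * n) : ℝ) : ℂ) *
      (-Complex.sin ((x:ℂ) * (Real.sin t : ℂ)) * (Real.sin t : ℂ)))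
      = ((∫ t in (0:ℝ)..(2 * π), -(Real.cos t ^ (2 * n) *
      (Real.sin (x * Real.sin t) * Real.sin t)) : ℝ) : ℂ) := by
    rw [← intervalIntegral.integral_ofReal]
    congr 1; ext t; push_cast; ring
  rw [h3, Complex.ofReal_re, intervalIntegral.integral_neg, MM]
  have := MM_ibp n x
  have hn : (2 * (n:ℝ) + 1) ≠ 0 := by positivity
  replace this := eq_div_of_mul_eq hn ((mul_comm _ _).trans this)
  rw [this]
  ring

theorem besselJ_one (x : ℝ) : besselJ 1 x = x * MM 1 x := by
  have h0 : ∫ t in (0:ℝ)..(2 * π), Real.cos t * Real.cos (x * Real.sin t) = 0 := by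
    by_cases hx : x = 0
    · subst hx; simp
    have h := intervalIntegral.integral_eq_sub_of_hasDerivAt (a := 0) (b := 2 * π)
      (f := fun t => Real.sin (x * Real.sin t))
      (f' := fun t => x * (Real.cos t * Real.cos (x * Real.sin t)))
      (fun t _ => by
        exact (((Real.hasDerivAt_sin t).const_mul x).sin).congr_deriv (by ring))
      (by apply Continuous.intervalIntegrable; fun_prop)
    rw [intervalIntegral.integral_const_mul] at h
    simpa [hx] using h
  have h1 := MM_ibp 0 x
  simp at h1
  rw [besselJ, MM]
  have : ∀ t, Real.cos (((1:ℤ):ℝ) * t - x * Real.sin t) = Real.cos t * Real.cos (x * Real.sin t)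
      + Real.sin (x * Real.sin t) * Real.sin t := by
    intro t; rw [Int.cast_one, one_mul, Real.cos_sub]; ring
  simp_rw [this]
  rw [intervalIntegral.integral_add (by apply Continuous.intervalIntegrable; fun_prop)
    (by apply Continuous.intervalIntegrable; fun_prop), h0, h1]
  simp; ring

theorem MM_mono (n : ℕ) {x : ℝ} (h0 : 0 ≤ x) (h1 : x ≤ 1) : MM (n + 1) x ≤ MM n x := by
  unfold MM
  have hp := Real.pi_pos
  apply mul_le_mul_of_nonneg_left _ (by positivity)
  apply intervalIntegral.integral_mono_on (by positivity)
    (by apply Continuous.intervalIntegrable; fun_prop)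
    (by apply Continuous.intervalIntegrable; fun_prop)
  intro t _
  have hc : 0 ≤ Real.cos (x * Real.sin t) := by
    apply Real.cos_nonneg_of_mem_Icc
    have := Real.sin_le_one t
    have := Real.neg_one_le_sin t
    have := Real.pi_gt_three
    constructor <;> nlinarith
  apply mul_le_mul_of_nonneg_right _ hc
  have e1 : Real.cos t ^ (2 * (n+1)) = Real.cos t ^ (2 * n) * Real.cos t ^ 2 := by ring
  rw [e1]
  have : 0 ≤ Real.cos t ^ (2 * n) := by rw [pow_mul]; positivity
  nlinarith [Real.cos_sq_le_one t]

theorem MM_le (n : ℕ) (x : ℝ) : MM n x ≤ MM n 0 := by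
  unfold MM
  have hp := Real.pi_pos
  apply mul_le_mul_of_nonneg_left _ (by positivity)
  apply intervalIntegral.integral_mono_on (by positivity)
    (by apply Continuous.intervalIntegrable; fun_prop)
    (by apply Continuous.intervalIntegrable; fun_prop)
  intro t _
  have : 0 ≤ Real.cos t ^ (2 * n) := by rw [pow_mul]; positivity
  apply mul_le_mul_of_nonneg_left _ this
  simpa using Real.cos_le_one _

theorem MM_ge (n : ℕ) (x : ℝ) : MM n 0 - x ^ 2 / 2 * (MM n 0 - MM (n + 1) 0) ≤ MM n x := by
  unfold MM
  have hp := Real.pi_pos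
  have : (1 / (2 * π)) * (∫ t in (0:ℝ)..(2 * π), (Real.cos t ^ (2 * n) * Real.cos (0 * Real.sin t)
     - x ^ 2 / 2 * (Real.cos t ^ (2 * n) * Real.cos (0 * Real.sin t) -
       Real.cos t ^ (2 * (n + 1)) * Real.cos (0 * Real.sin t))))
     ≤ (1 / (2 * π)) * ∫ t in (0:ℝ)..(2 * π), Real.cos t ^ (2 * n) * Real.cos (x * Real.sin t) := by
    apply mul_le_mul_of_nonneg_left _ (by positivity)
    apply intervalIntegral.integral_mono_on (by positivity)
      (by apply Continuous.intervalIntegrable; fun_prop)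
      (by apply Continuous.intervalIntegrable; fun_prop)
    intro t _
    have e1 : Real.cos t ^ (2 * (n+1)) = Real.cos t ^ (2 * n) * Real.cos t ^ 2 := by ring
    rw [e1]
    have : 0 ≤ Real.cos t ^ (2 * n) := by rw [pow_mul]; positivity
    simp only [zero_mul, Real.cos_zero, mul_one]
    have h2 := mul_le_mul_of_nonneg_left (Real.one_sub_sq_div_two_le_cos (x := x * Real.sin t)) this
    have h3 : Real.cos t ^ 2 = 1 - Real.sin t ^ 2 := by linarith [Real.sin_sq_add_cos_sq t]
    rw [h3]
    nlinarith
  rw [intervalIntegral.integral_sub (by apply Continuous.intervalIntegrable; fun_prop)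
    (by apply Continuous.intervalIntegrable; fun_prop), intervalIntegral.integral_const_mul,
    intervalIntegral.integral_sub (by apply Continuous.intervalIntegrable; fun_prop)
    (by apply Continuous.intervalIntegrable; fun_prop)] at this
  linarith

theorem MM_zero_rec (n : ℕ) : MM (n + 1) 0 = (2 * n + 1) / (2 * n + 2) * MM n 0 := by
  unfold MM
  have := integral_cos_pow (a := 0) (b := 2 * π) (n := 2 * n)
  have e : 2 * (n + 1) = 2 * n + 2 := by ring
  simp only [zero_mul, Real.cos_zero, mul_one, e]
  rw [this]
  simp
  ring

theorem MM0 : MM 0 0 = 1 := by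
  unfold MM
  have := Real.pi_pos
  simp
  field_simp

theorem MM1 : MM 1 0 = 1 / 2 := by
  have := MM_zero_rec 0; rw [MM0] at this; norm_num at this; simpa using this
theorem MM2 : MM 2 0 = 3 / 8 := by
  have := MM_zero_rec 1; rw [MM1] at this; norm_num at this; simpa using this
theorem MM3 : MM 3 0 = 5 / 16 := by
  have := MM_zero_rec 2; rw [MM2] at this; norm_num at this; simpa using this
theorem MM4 : MM 4 0 = 35 / 128 := by
  have := MM_zero_rec 3; rw [MM3] at this; norm_num at this; simpa using this

theorem MM_bounds {x : ℝ} (h0 : 0 ≤ x) (h1 : x ≤ 1) :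
    0 < MM 3 x ∧ MM 3 x ≤ MM 2 x ∧ MM 2 x ≤ MM 1 x ∧ MM 1 x ≤ 1 / 2 ∧
      3 / 8 - x ^ 2 / 32 ≤ MM 2 x := by
  refine ⟨?_, MM_mono 2 h0 h1, MM_mono 1 h0 h1, MM1 ▸ MM_le 1 x, ?_⟩
  · have := MM_ge 3 x
    norm_num [MM3, MM4] at this
    nlinarith
  · have := MM_ge 2 x
    norm_num [MM3, MM2] at this
    nlinarith

noncomputable def fa (e : ℝ) : ℝ := -4 * (e * MM 1 e + 2 / 3 * (e - e ^ 3) * MM 2 e)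
noncomputable def fb (e : ℝ) : ℝ := -8 * e * (MM 1 e - MM 2 e / 3)
noncomputable def al (e : ℝ) : ℝ := -4 * (MM 1 e + (2 / 3 - 7 / 3 * e ^ 2) * MM 2 e
  - 2 / 15 * e ^ 2 * (1 - e ^ 2) * MM 3 e)
noncomputable def be (e : ℝ) : ℝ := -8 * ((1 - 2 * e ^ 2) * (MM 1 e - MM 2 e / 3) +
  (1 - e ^ 2) * (-(e ^ 2 / 3) * MM 2 e + e ^ 2 / 15 * MM 3 e))

theorem dM1 (x : ℝ) : HasDerivAt (MM 1) (-(x / 3) * MM 2 x) x := by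
  have := MM_hasDerivAt 1 x; norm_num at this; simpa using this
theorem dM2 (x : ℝ) : HasDerivAt (MM 2) (-(x / 5) * MM 3 x) x := by
  have := MM_hasDerivAt 2 x; norm_num at this; simpa using this

theorem besselJd_one (x : ℝ) : besselJd 1 x = MM 1 x - x ^ 2 / 3 * MM 2 x := by
  have h : besselJ 1 = fun x => x * MM 1 x := funext besselJ_one
  rw [besselJd, h]
  refine (((hasDerivAt_id x).mul (dM1 x)).congr_deriv ?_).deriv
  simp; ring

theorem coefA_eq {e : ℝ} (he : e ≠ 0) : coefA 1 e = fa e := by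
  have h1 := besselJd_one e
  have h2 := besselJ_one e
  unfold coefA fa
  simp only [Nat.cast_one, one_mul, one_pow, mul_one]
  rw [h1, h2]
  field_simp
  ring

theorem coefB_eq {e : ℝ} (he : e ≠ 0) : coefB 1 e = Real.sqrt (1 - e ^ 2) * fb e := by
  have h1 := besselJd_one e
  have h2 := besselJ_one e
  unfold coefB fb
  simp only [Nat.cast_one, one_mul, one_pow, mul_one]
  rw [h1, h2]
  field_simp
  ring

theorem al_analytic (x : ℝ) : AnalyticAt ℝ al x := by
  have h1 := MM_analytic 1 x
  have h2 := MM_analytic 2 x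
  have h3 := MM_analytic 3 x
  unfold al
  fun_prop
theorem be_analytic (x : ℝ) : AnalyticAt ℝ be x := by
  have h1 := MM_analytic 1 x
  have h2 := MM_analytic 2 x
  have h3 := MM_analytic 3 x
  unfold be
  fun_prop

theorem fa_deriv (e : ℝ) : HasDerivAt fa (al e) e := by
  have h := (((hasDerivAt_id e).mul (dM1 e)).add
    ((((hasDerivAt_id e).sub (hasDerivAt_pow 3 e)).const_mul (2/3)).mul (dM2 e))).const_mul (-4)
  refine h.congr_deriv ?_
  simp [al]; ring

theorem sq_deriv {e : ℝ} (he : 0 < 1 - e ^ 2) :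
    HasDerivAt (fun e => Real.sqrt (1 - e ^ 2)) (-e / Real.sqrt (1 - e ^ 2)) e := by
  have h := ((hasDerivAt_pow 2 e).const_sub 1).sqrt he.ne'
  refine h.congr_deriv ?_
  have := Real.sqrt_pos.2 he
  field_simp
  simp

theorem fb_deriv {e : ℝ} (he : 0 < 1 - e ^ 2) :
    HasDerivAt (fun e => Real.sqrt (1 - e ^ 2) * fb e) (be e / Real.sqrt (1 - e ^ 2)) e := by
  have h := (sq_deriv he).mul (((hasDerivAt_id e).const_mul (-8)).mul
    ((dM1 e).sub ((dM2 e).div_const 3)))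
  refine h.congr_deriv ?_
  have h1 := Real.sqrt_pos.2 he
  have h2 := Real.sq_sqrt he.le
  simp only [be, id, Pi.mul_apply, Pi.sub_apply]
  field_simp
  rw [h2]
  ring

theorem one_sub_pos {e : ℝ} (he : e ∈ Ioo (0:ℝ) 1) : 0 < 1 - e ^ 2 := by
  nlinarith [he.1, he.2]

theorem dcoefA {e : ℝ} (he : e ∈ Ioo (0:ℝ) 1) : HasDerivAt (coefA 1) (al e) e := by
  refine (fa_deriv e).congr_of_eventuallyEq ?_
  filter_upwards [Ioo_mem_nhds he.1 he.2] with x hx using coefA_eq hx.1.ne'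
theorem dcoefB {e : ℝ} (he : e ∈ Ioo (0:ℝ) 1) :
    HasDerivAt (coefB 1) (be e / Real.sqrt (1 - e ^ 2)) e := by
  refine (fb_deriv (one_sub_pos he)).congr_of_eventuallyEq ?_
  filter_upwards [Ioo_mem_nhds he.1 he.2] with x hx using coefB_eq hx.1.ne'

theorem ddcoefA {e : ℝ} (he : e ∈ Ioo (0:ℝ) 1) : HasDerivAt (deriv (coefA 1)) (deriv al e) e := by
  refine (al_analytic e).differentiableAt.hasDerivAt.congr_of_eventuallyEq ?_
  filter_upwards [Ioo_mem_nhds he.1 he.2] with x hx using (dcoefA hx).deriv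
theorem ddcoefB {e : ℝ} (he : e ∈ Ioo (0:ℝ) 1) :
    HasDerivAt (deriv (coefB 1)) ((deriv be e * (1 - e ^ 2) + e * be e) /
      (Real.sqrt (1 - e ^ 2) * (1 - e ^ 2))) e := by
  have h0 := one_sub_pos he
  have hs := Real.sqrt_pos.2 h0
  have h2 := Real.sq_sqrt h0.le
  have h := ((be_analytic e).differentiableAt.hasDerivAt.div (sq_deriv h0) hs.ne')
  have h' := h.congr_of_eventuallyEq (f₁ := deriv (coefB 1)) (by
    filter_upwards [Ioo_mem_nhds he.1 he.2] with x hx using (dcoefB hx).deriv)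
  refine h'.congr_deriv ?_
  rw [h2]
  field_simp
  rw [h2]
  ring

theorem P_neg {e : ℝ} (he : e ∈ Ioo (0:ℝ) 1) : coefA 1 e + coefB 1 e < 0 := by
  rw [coefA_eq he.1.ne', coefB_eq he.1.ne']
  have h0 := one_sub_pos he
  have hs := Real.sqrt_pos.2 h0
  obtain ⟨b1, b2, b3, b4, b5⟩ := MM_bounds he.1.le he.2.le
  have h1 : 0 < -fa e := by
    have : -fa e = 4 * e * (MM 1 e + 2 / 3 * (1 - e ^ 2) * MM 2 e) := by unfold fa; ring
    rw [this]
    have := he.1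
    have : 0 < MM 2 e := by linarith
    have : 0 < MM 1 e := by linarith
    positivity
  have h2 : 0 < -fb e := by
    have : -fb e = 8 * e * (MM 1 e - MM 2 e / 3) := by unfold fb; ring
    rw [this]
    have := he.1
    have : 0 < MM 1 e - MM 2 e / 3 := by linarith
    positivity
  nlinarith

theorem Q_neg {e : ℝ} (he : e ∈ Ioo (0:ℝ) 1) : coefA 1 e - coefB 1 e < 0 := by
  rw [coefA_eq he.1.ne', coefB_eq he.1.ne']
  have h0 := one_sub_pos he
  have hs := Real.sqrt_pos.2 h0
  have h2 := Real.sq_sqrt h0.le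
  have hs1 : Real.sqrt (1 - e ^ 2) < 1 := by nlinarith [he.1]
  obtain ⟨b1, b2, b3, b4, b5⟩ := MM_bounds he.1.le he.2.le
  have h3 : fa e - Real.sqrt (1 - e ^ 2) * fb e = -4 * e * ((1 - 2 * Real.sqrt (1 - e ^ 2)) * MM 1 e
    + 2 / 3 * Real.sqrt (1 - e ^ 2) * (1 + Real.sqrt (1 - e ^ 2)) * MM 2 e) := by
    unfold fa fb
    linear_combination (8 / 3 * e * MM 2 e) * h2
  rw [h3]
  generalize Real.sqrt (1 - e ^ 2) = s at *
  have he2 : e ^ 2 = (1 - s) * (1 + s) := by linarith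
  rw [he2] at b5
  have key : 0 < (1 - 2 * s) * MM 1 e + 2 / 3 * s * (1 + s) * MM 2 e := by
    have hM : 0 < MM 2 e := by linarith
    have hp : 0 < s * (1 + s) := by positivity
    rcases le_total s (1/2) with h | h
    · have : 0 ≤ (1 - 2 * s) * MM 1 e := mul_nonneg (by linarith) (by linarith)
      have : 0 < 2 / 3 * s * (1 + s) * MM 2 e := by positivity
      linarith
    · have i1 : (1 - 2 * s) * (1 / 2) ≤ (1 - 2 * s) * MM 1 e :=
        mul_le_mul_of_nonpos_left b4 (by linarith)
      have i2 := mul_le_mul_of_nonneg_left b5 hp.le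
      have i3 : 0 < (1 - s) * ((2 - s) / 4 - s * (1 + s) ^ 2 / 48) := by
        apply mul_pos (by linarith)
        nlinarith [mul_pos hs hs, mul_pos (mul_pos hs hs) (sub_pos.2 hs1), mul_pos hs (sub_pos.2 hs1)]
      nlinarith
  nlinarith [mul_pos he.1 key]

theorem al_or_be {e : ℝ} (he : e ∈ Ioo (0:ℝ) 1) : al e ≠ 0 ∨ be e ≠ 0 := by
  have h0 := one_sub_pos he
  obtain ⟨b1, b2, b3, b4, b5⟩ := MM_bounds he.1.le he.2.le
  have he2 := sq_pos_of_pos he.1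
  rcases le_total (e ^ 2) (1 / 2) with h | h
  · left
    have h1 : -(1 / 2) * MM 2 e ≤ (2 / 3 - 7 / 3 * e ^ 2) * MM 2 e :=
      mul_le_mul_of_nonneg_right (by linarith) (by linarith)
    have h2 : 2 / 15 * e ^ 2 * (1 - e ^ 2) * MM 3 e ≤ 2 / 15 * MM 3 e :=
      mul_le_mul_of_nonneg_right (by nlinarith) b1.le
    unfold al
    have : 0 < (MM 1 e + (2 / 3 - 7 / 3 * e ^ 2) * MM 2 e - 2 / 15 * e ^ 2 * (1 - e ^ 2) * MM 3 e) := by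
      linarith
    linarith
  · right
    unfold be
    have h1 : (1 - 2 * e ^ 2) * (MM 1 e - MM 2 e / 3) ≤ 0 :=
      mul_nonpos_of_nonpos_of_nonneg (by linarith) (by linarith)
    have h2 : 0 < (1 - e ^ 2) * (e ^ 2 * (MM 2 e / 3 - MM 3 e / 15)) :=
      mul_pos h0 (mul_pos he2 (by linarith))
    nlinarith

theorem al_zero : al 0 = -3 := by simp [al, MM1, MM2]; norm_num
theorem be_zero : be 0 = -3 := by simp [be, MM1, MM2]; norm_num
theorem al_one : 0 < al 1 := by
  obtain ⟨b1, b2, b3, b4, b5⟩ := MM_bounds (x := 1) (by norm_num) le_rfl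
  unfold al; linarith
theorem be_one : 0 < be 1 := by
  obtain ⟨b1, b2, b3, b4, b5⟩ := MM_bounds (x := 1) (by norm_num) le_rfl
  unfold be; linarith

theorem finite_zeros {f : ℝ → ℝ} (hf : ∀ x, AnalyticAt ℝ f x) (h1 : f 1 ≠ 0) :
    {e | e ∈ Ioo (0:ℝ) 1 ∧ f e = 0}.Finite := by
  have h : AnalyticOnNhd ℝ f (Icc 0 1) := fun x _ => hf x
  have h2 := h.preimage_zero_mem_codiscreteWithin h1 (by simp) (isConnected_Icc zero_le_one)
  refine (isCompact_Icc.finite_sdiff_of_mem_codiscreteWithin h2).subset ?_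
  rintro e ⟨he, h⟩
  exact ⟨Ioo_subset_Icc_self he, by simpa using h⟩

noncomputable def VV (e : ℝ) : ℝ :=
  al e * (deriv be e * (1 - e ^ 2) + e * be e) - deriv al e * be e * (1 - e ^ 2)

theorem VV_finite : {e | e ∈ Ioo (0:ℝ) 1 ∧ VV e = 0}.Finite := by
  apply finite_zeros
  · intro x
    have h1 := al_analytic x
    have h2 := be_analytic x
    have h3 := h1.deriv
    have h4 := h2.deriv
    unfold VV
    fun_prop
  · simp [VV, al_one.ne', be_one.ne']

theorem dense_quad (a b : ℝ) (hab : a ≠ 0 ∨ b ≠ 0) :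
    Dense {p : ℝ × ℝ × ℝ | a * (p.1 ^ 2 + p.2.1 ^ 2) + b * (2 * p.1 * p.2.1 * Real.sin p.2.2) ≠ 0} := by
  rw [dense_iff_inter_open]
  rintro O hO ⟨⟨x, y, r⟩, hx⟩
  obtain ⟨u, v, hu, hv, hxu, hyv, huv⟩ := isOpen_prod_iff.1 hO x (y, r) hx
  obtain ⟨v1, v2, hv1, hv2, hyv1, hrv2, hvv⟩ := isOpen_prod_iff.1 hv y r hyv
  obtain ⟨y', hy', hy0⟩ : ∃ y' ∈ v1, y' ≠ 0 := by
    obtain ⟨z, hz, hz'⟩ := (dense_compl_singleton (0:ℝ)).inter_open_nonempty v1 hv1 ⟨y, hyv1⟩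
    exact ⟨z, hz, hz'⟩
  obtain ⟨r', hr', hr0⟩ : ∃ r' ∈ v2, Real.sin r' ≠ 0 := by
    have hc : (Set.range fun n : ℤ => (n : ℝ) * π).Countable := countable_range _
    obtain ⟨z, hz, hz'⟩ := (hc.dense_compl ℝ).inter_open_nonempty v2 hv2 ⟨r, hrv2⟩
    refine ⟨z, hz, fun h => hz' ?_⟩
    obtain ⟨n, hn⟩ := Real.sin_eq_zero_iff.1 h
    exact ⟨n, hn⟩
  have hfin : {x : ℝ | a * (x ^ 2 + y' ^ 2) + b * (2 * x * y' * Real.sin r') = 0}.Finite := by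
    obtain ⟨c1, hc1⟩ : ∃ c, c = 2 * b * y' * Real.sin r' := ⟨_, rfl⟩
    obtain ⟨c0, hc0⟩ : ∃ c, c = a * y' ^ 2 := ⟨_, rfl⟩
    set q : Polynomial ℝ := Polynomial.C a * Polynomial.X ^ 2
      + Polynomial.C c1 * Polynomial.X + Polynomial.C c0 with hq
    have hq0 : q ≠ 0 := by
      intro h
      have h2 : q.coeff 2 = 0 := by rw [h]; simp
      have h1 : q.coeff 1 = 0 := by rw [h]; simp
      simp [hq, Polynomial.coeff_C] at h1 h2
      rcases hab with h | h
      · exact h h2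
      · rw [hc1] at h1
        simp [h, hy0, hr0] at h1
    refine (q.rootSet_finite ℝ).subset ?_
    intro x hx
    rw [Polynomial.mem_rootSet]
    refine ⟨hq0, ?_⟩
    simp [hq]
    have hx2 : a * (x ^ 2 + y' ^ 2) + b * (2 * x * y' * Real.sin r') = 0 := hx
    rw [hc0, hc1]
    linear_combination hx2
  obtain ⟨x', hx', hx0⟩ := (hfin.countable.dense_compl ℝ).inter_open_nonempty u hu ⟨x, hxu⟩
  exact ⟨(x', y', r'), huv ⟨hx', hvv ⟨hy', hr'⟩⟩, hx0⟩

theorem cos_fin (R : ℝ) (hR : 0 ≤ R) : {u | u ∈ Icc (-R) R ∧ Real.cos u = 0}.Finite := by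
  have h : AnalyticOnNhd ℝ Real.cos (Icc (-R) R) := fun x _ => Real.analyticAt_cos
  have h2 := h.preimage_zero_mem_codiscreteWithin (x := 0) (by simp) (by simp [hR])
    (isConnected_Icc (by linarith))
  refine (isCompact_Icc.finite_sdiff_of_mem_codiscreteWithin h2).subset ?_
  rintro e ⟨he, h⟩
  exact ⟨he, by simpa using h⟩

theorem angle_exists (x y r : ℝ) (hr : 0 < r) (h : x ^ 2 + y ^ 2 = r ^ 2) :
    ∃ σ : ℝ, r * Real.cos σ = x ∧ r * Real.sin σ = y := by
  have hn : ‖(⟨x, y⟩ : ℂ)‖ = r := by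
    rw [Complex.norm_def, Complex.normSq_mk, ← Real.sqrt_sq hr.le, ← h]; congr 1; ring
  refine ⟨Complex.arg ⟨x, y⟩, ?_, ?_⟩
  · rw [← hn, Complex.norm_mul_cos_arg]
  · rw [← hn, Complex.norm_mul_sin_arg]

theorem sol_char {α β ρ σ τ : ℝ} (hE : 0 < calE α β ρ) (hF : 0 < calF α β ρ) {p : ℝ × ℝ × ℝ}
    (hp : p ∈ bifSolSet 1 α β ρ σ τ) :
    Real.cos (2 * p.2.2 + p.2.1 + τ) = 0 ∧ Real.cos (2 * p.2.2 - p.2.1 + σ) = 0 := by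
  obtain ⟨he, -, -, h1, h2, -⟩ := hp
  simp only [bifF1, bifF2, Nat.cast_one, one_mul] at h1 h2
  constructor
  · simpa [hF.ne', (P_neg he).ne] using h1
  · simpa [hE.ne', (Q_neg he).ne] using h2

theorem sol_eq {α β ρ σ τ : ℝ} {p : ℝ × ℝ × ℝ}
    (hp : p ∈ bifSolSet 1 α β ρ σ τ) :
    al p.1 * Real.sqrt (1 - p.1 ^ 2) * (calF α β ρ * Real.sin (2 * p.2.2 + p.2.1 + τ) +
      calE α β ρ * Real.sin (2 * p.2.2 - p.2.1 + σ)) +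
    be p.1 * (calF α β ρ * Real.sin (2 * p.2.2 + p.2.1 + τ) -
      calE α β ρ * Real.sin (2 * p.2.2 - p.2.1 + σ)) = 0 := by
  obtain ⟨he, -, -, -, -, h3⟩ := hp
  have h0 := one_sub_pos he
  have hs := Real.sqrt_pos.2 h0
  simp only [bifF3, Nat.cast_one, one_mul, (dcoefA he).deriv, (dcoefB he).deriv] at h3
  field_simp at h3
  linear_combination h3

noncomputable def gw (E F w e : ℝ) : ℝ :=
  al e ^ 2 * (1 - e ^ 2) * (F + w * E) ^ 2 - be e ^ 2 * (F - w * E) ^ 2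

theorem gw_fin (E F w : ℝ) (h : F - w * E ≠ 0) :
    {e | e ∈ Ioo (0:ℝ) 1 ∧ gw E F w e = 0}.Finite := by
  apply finite_zeros
  · intro x
    have h1 := al_analytic x
    have h2 := be_analytic x
    unfold gw
    fun_prop
  · simp [gw, be_one.ne', h]

theorem sin_of_cos {u : ℝ} (h : Real.cos u = 0) : Real.sin u = 1 ∨ Real.sin u = -1 := by
  have := Real.sin_sq_add_cos_sq u
  rw [h] at this
  have h2 : (Real.sin u - 1) * (Real.sin u + 1) = 0 := by linear_combination this
  rcases mul_eq_zero.1 h2 with h3 | h3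
  · left; linarith
  · right; linarith

theorem sol_finite {α β ρ σ τ : ℝ} (hE : 0 < calE α β ρ) (hF : 0 < calF α β ρ)
    (hEF : calE α β ρ ≠ calF α β ρ) : (bifSolSet 1 α β ρ σ τ).Finite := by
  have hpi := Real.pi_pos
  set E := calE α β ρ with hEd
  set F := calF α β ρ with hFd
  have f1 := gw_fin E F 1 (by rw [one_mul, sub_ne_zero]; exact hEF.symm)
  have f2 := gw_fin E F (-1) (by nlinarith)
  have f3 := cos_fin (10 * π + |τ|) (by positivity)
  have f4 := cos_fin (10 * π + |σ|) (by positivity)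
  have hf := (f1.union f2).prod (f3.prod f4)
  refine Set.Finite.of_finite_image (f := fun p : ℝ × ℝ × ℝ =>
    (p.1, 2 * p.2.2 + p.2.1 + τ, 2 * p.2.2 - p.2.1 + σ)) (hf.subset ?_) ?_
  · rintro _ ⟨p, hp, rfl⟩
    obtain ⟨c1, c2⟩ := sol_char hE hF hp
    have h3 := sol_eq hp
    obtain ⟨he, hl, hg, -⟩ := hp
    have h0 := one_sub_pos he
    have hs := Real.sqrt_pos.2 h0
    have h2 := Real.sq_sqrt h0.le
    have a1 := le_abs_self τ
    have a2 := neg_abs_le τ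
    have a3 := le_abs_self σ
    have a4 := neg_abs_le σ
    refine ⟨?_, ⟨⟨?_, ?_⟩, c1⟩, ⟨⟨?_, ?_⟩, c2⟩⟩
    · simp only
      rw [← hEd, ← hFd] at h3
      rcases sin_of_cos c1 with s1 | s1 <;> rcases sin_of_cos c2 with s2 | s2 <;>
        rw [s1, s2] at h3
      · left; refine ⟨he, ?_⟩
        unfold gw; rw [← h2]
        linear_combination (al p.1 * √(1 - p.1 ^ 2) * (F + E) - be p.1 * (F - E)) * h3
      · right; refine ⟨he, ?_⟩
        unfold gw; rw [← h2]
        linear_combination (al p.1 * √(1 - p.1 ^ 2) * (F - E) - be p.1 * (F + E)) * h3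
      · right; refine ⟨he, ?_⟩
        unfold gw; rw [← h2]
        linear_combination (-al p.1 * √(1 - p.1 ^ 2) * (F - E) + be p.1 * (F + E)) * h3
      · left; refine ⟨he, ?_⟩
        unfold gw; rw [← h2]
        linear_combination (-al p.1 * √(1 - p.1 ^ 2) * (F + E) + be p.1 * (F - E)) * h3
    all_goals simp only; linarith [hl.1, hl.2, hg.1, hg.2]
  · rintro ⟨e, l, g⟩ - ⟨e', l', g'⟩ - h
    simp only [Prod.mk.injEq] at h ⊢
    obtain ⟨h1, h2, h3⟩ := h
    exact ⟨h1, by linarith, by linarith⟩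

theorem sol_nonempty {α β ρ σ τ : ℝ} (hE : 0 < calE α β ρ) (hF : 0 < calF α β ρ) :
    (bifSolSet 1 α β ρ σ τ).Nonempty := by
  have hpi := Real.two_pi_pos
  set E := calE α β ρ with hEd
  set F := calF α β ρ with hFd
  obtain ⟨e, he, hz⟩ : ∃ e ∈ Ioo (0:ℝ) 1,
      al e * Real.sqrt (1 - e ^ 2) * (F - E) + be e * (F + E) = 0 := by
    have hc : ContinuousOn (fun e => al e * Real.sqrt (1 - e ^ 2) * (F - E) + be e * (F + E))
        (Icc 0 1) := by
      have h1 : Continuous al := continuous_iff_continuousAt.2 fun x => (al_analytic x).continuousAt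
      have h2 : Continuous be := continuous_iff_continuousAt.2 fun x => (be_analytic x).continuousAt
      fun_prop
    have h := intermediate_value_Ioo zero_le_one hc
    have hm : (0:ℝ) ∈ Ioo (al 0 * Real.sqrt (1 - 0 ^ 2) * (F - E) + be 0 * (F + E))
        (al 1 * Real.sqrt (1 - 1 ^ 2) * (F - E) + be 1 * (F + E)) := by
      constructor
      · simp [al_zero, be_zero]; linarith
      · have := mul_pos be_one (add_pos hF hE)
        simpa using this
    obtain ⟨e, he, hz⟩ := h hm
    exact ⟨e, he, hz⟩
  have h0 := one_sub_pos he
  have hs := Real.sqrt_pos.2 h0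
  set l0 := (π - τ + σ) / 2 with hl0
  set g0 := (-τ - σ) / 4 with hg0
  set kl := toIcoDiv hpi 0 l0 with hkl
  set kg := toIcoDiv hpi 0 g0 with hkg
  have el : toIcoMod hpi 0 l0 = l0 - kl * (2 * π) := by
    rw [toIcoMod, zsmul_eq_mul]
  have eg : toIcoMod hpi 0 g0 = g0 - kg * (2 * π) := by
    rw [toIcoMod, zsmul_eq_mul]
  have ml := toIcoMod_mem_Ico' hpi l0
  have mg := toIcoMod_mem_Ico' hpi g0
  rw [el] at ml
  rw [eg] at mg
  have eu : 2 * (g0 - kg * (2 * π)) + (l0 - kl * (2 * π)) + τ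
      = π / 2 - ((2 * kg + kl : ℤ) : ℝ) * (2 * π) := by
    push_cast; rw [hl0, hg0]; ring
  have ev : 2 * (g0 - kg * (2 * π)) - (l0 - kl * (2 * π)) + σ
      = -(π / 2) - ((2 * kg - kl : ℤ) : ℝ) * (2 * π) := by
    push_cast; rw [hl0, hg0]; ring
  refine ⟨(e, l0 - kl * (2 * π), g0 - kg * (2 * π)), he, ml, mg, ?_, ?_, ?_⟩
  · simp only [bifF1, Nat.cast_one, one_mul]
    rw [eu, Real.cos_sub_int_mul_two_pi]; simp
  · simp only [bifF2, Nat.cast_one, one_mul]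
    rw [ev, Real.cos_sub_int_mul_two_pi]; simp
  · simp only [bifF3, Nat.cast_one, one_mul]
    rw [eu, ev, Real.sin_sub_int_mul_two_pi, Real.sin_sub_int_mul_two_pi, (dcoefA he).deriv,
      (dcoefB he).deriv, Real.sin_neg, Real.sin_pi_div_two, ← hEd, ← hFd]
    field_simp
    linear_combination hz

theorem sol_simple {α β ρ σ τ : ℝ} (hE : 0 < calE α β ρ) (hF : 0 < calF α β ρ)
    (hZ : ∀ e ∈ Ioo (0:ℝ) 1, VV e = 0 →
      (deriv (coefA 1) e + deriv (coefB 1) e) ^ 2 * calF α β ρ ^ 2 ≠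
      (deriv (coefA 1) e - deriv (coefB 1) e) ^ 2 * calE α β ρ ^ 2)
    {p : ℝ × ℝ × ℝ} (hp : p ∈ bifSolSet 1 α β ρ σ τ) :
    bifJac 1 α β ρ σ τ p.1 p.2.1 p.2.2 ≠ 0 := by
  obtain ⟨c1, c2⟩ := sol_char hE hF hp
  obtain ⟨he, -, -, -, -, h3⟩ := hp
  obtain ⟨e, l, g⟩ := p
  simp only at c1 c2 he h3 ⊢
  have hP := P_neg he
  have hQ := Q_neg he
  have h0 := one_sub_pos he
  have hs := Real.sqrt_pos.2 h0
  set E := calE α β ρ with hEd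
  set F := calF α β ρ with hFd
  have s1 := sin_of_cos c1
  have s2 := sin_of_cos c2
  have q1 : Real.sin (2 * g + l + τ) ^ 2 = 1 := by rcases s1 with h | h <;> rw [h] <;> norm_num
  have q2 : Real.sin (2 * g - l + σ) ^ 2 = 1 := by rcases s2 with h | h <;> rw [h] <;> norm_num
  have d1 : deriv (fun x => bifF1 1 α β ρ τ x l g) e = 0 := by
    simp only [bifF1, Nat.cast_one, one_mul, c1, mul_zero, deriv_const]
  have d2 : deriv (fun x => bifF1 1 α β ρ τ e x g) l =
      -(F * (coefA 1 e + coefB 1 e) * Real.sin (2 * g + l + τ)) := by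
    simp only [bifF1, Nat.cast_one, one_mul]
    have h := ((((hasDerivAt_id l).const_add (2 * g)).add_const τ).cos).const_mul
      (F * (coefA 1 e + coefB 1 e))
    refine (h.congr_deriv ?_).deriv
    simp
  have d3 : deriv (fun x => bifF1 1 α β ρ τ e l x) g =
      -2 * (F * (coefA 1 e + coefB 1 e) * Real.sin (2 * g + l + τ)) := by
    simp only [bifF1, Nat.cast_one, one_mul]
    have h := (((((hasDerivAt_id g).const_mul 2).add_const l).add_const τ).cos).const_mul
      (F * (coefA 1 e + coefB 1 e))
    refine (h.congr_deriv ?_).deriv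
    simp; ring
  have d4 : deriv (fun x => bifF2 1 α β ρ σ x l g) e = 0 := by
    simp only [bifF2, Nat.cast_one, one_mul, c2, mul_zero, deriv_const]
  have d5 : deriv (fun x => bifF2 1 α β ρ σ e x g) l =
      E * (coefA 1 e - coefB 1 e) * Real.sin (2 * g - l + σ) := by
    simp only [bifF2, Nat.cast_one, one_mul]
    have h := ((((hasDerivAt_id l).const_sub (2 * g)).add_const σ).cos).const_mul
      (E * (coefA 1 e - coefB 1 e))
    refine (h.congr_deriv ?_).deriv
    simp
  have d6 : deriv (fun x => bifF2 1 α β ρ σ e l x) g =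
      -2 * (E * (coefA 1 e - coefB 1 e) * Real.sin (2 * g - l + σ)) := by
    simp only [bifF2, Nat.cast_one, one_mul]
    have h := (((((hasDerivAt_id g).const_mul 2).sub_const l).add_const σ).cos).const_mul
      (E * (coefA 1 e - coefB 1 e))
    refine (h.congr_deriv ?_).deriv
    simp; ring
  have d7 : deriv (fun x => bifF3 1 α β ρ σ τ x l g) e =
      (deriv al e + ((deriv be e * (1 - e ^ 2) + e * be e) /
      (Real.sqrt (1 - e ^ 2) * (1 - e ^ 2)))) * F * Real.sin (2 * g + l + τ) +
      (deriv al e - ((deriv be e * (1 - e ^ 2) + e * be e) /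
      (Real.sqrt (1 - e ^ 2) * (1 - e ^ 2)))) * E * Real.sin (2 * g - l + σ) := by
    simp only [bifF3, Nat.cast_one, one_mul]
    exact (((((ddcoefA he).add (ddcoefB he)).mul_const F).mul_const _).add
      ((((ddcoefA he).sub (ddcoefB he)).mul_const E).mul_const _)).deriv
  have hJ : bifJac 1 α β ρ σ τ e l g = 4 * F * E * (coefA 1 e + coefB 1 e) *
      (coefA 1 e - coefB 1 e) * Real.sin (2 * g + l + τ) * Real.sin (2 * g - l + σ) *
      deriv (fun x => bifF3 1 α β ρ σ τ x l g) e := by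
    unfold bifJac
    rw [Matrix.det_fin_three]
    simp only [Matrix.of_apply, Matrix.cons_val]
    rw [d1, d2, d3, d4, d5, d6]
    ring
  have n1 : Real.sin (2 * g + l + τ) ≠ 0 := by intro h; rw [h] at q1; norm_num at q1
  have n2 : Real.sin (2 * g - l + σ) ≠ 0 := by intro h; rw [h] at q2; norm_num at q2
  have n3 : deriv (fun x => bifF3 1 α β ρ σ τ x l g) e ≠ 0 := by
    intro hd
    rw [d7] at hd
    have hz := hZ e he
    simp only [bifF3, Nat.cast_one, one_mul] at h3
    rw [← hEd, ← hFd] at h3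
    have hne : (deriv (coefA 1) e + deriv (coefB 1) e) ^ 2 * F ^ 2 =
      (deriv (coefA 1) e - deriv (coefB 1) e) ^ 2 * E ^ 2 := by
      generalize deriv (coefA 1) e = a at *
      generalize deriv (coefB 1) e = b at *
      have : ((a + b) * F * Real.sin (2 * g + l + τ)) ^ 2 =
        ((a - b) * E * Real.sin (2 * g - l + σ)) ^ 2 := by
        linear_combination ((a + b) * F * Real.sin (2 * g + l + τ)
          - (a - b) * E * Real.sin (2 * g - l + σ)) * h3
      rw [mul_pow, mul_pow, mul_pow, mul_pow, q1, q2, mul_one, mul_one] at this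
      exact this
    refine hz ?_ hne
    rw [(dcoefA he).deriv, (dcoefB he).deriv] at h3
    generalize Real.sin (2 * g + l + τ) = x at *
    generalize Real.sin (2 * g - l + σ) = y at *
    generalize Real.sqrt (1 - e ^ 2) = s at *
    unfold VV
    generalize deriv al e = a' at *
    generalize deriv be e = b' at *
    generalize al e = a at *
    generalize be e = b at *
    generalize 1 - e ^ 2 = t at *
    -- two vectors orthogonal to (F x + E y, F x - E y)
    have k1 : a * s * (F * x + E * y) + b * (F * x - E * y) = 0 := by
      field_simp at h3; linear_combination h3
    have k2 : a' * s * t * (F * x + E * y) + (b' * t + e * b) * (F * x - E * y) = 0 := by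
      field_simp at hd; linear_combination hd
    have k3 : (a * (b' * t + e * b) - a' * b * t) * (F * x - E * y) = 0 := by
      have : s * ((a * (b' * t + e * b) - a' * b * t) * (F * x - E * y)) = 0 := by
        linear_combination (a * s) * k2 - (a' * s * t) * k1
      simpa [hs.ne'] using this
    have k4 : (a * (b' * t + e * b) - a' * b * t) * (F * x + E * y) = 0 := by
      have : s * ((a * (b' * t + e * b) - a' * b * t) * (F * x + E * y)) = 0 := by
        linear_combination (b' * t + e * b) * k1 - b * k2
      simpa [hs.ne'] using this
    have k5 : (a * (b' * t + e * b) - a' * b * t) * (F * x) = 0 := by linarith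
    simpa [hF.ne', n1] using k5
  rw [hJ]
  have := hP.ne
  have := hQ.ne
  have := hE.ne'
  have := hF.ne'
  positivity

theorem stmt_16 :
    ∃ U : Set (ℝ × ℝ × ℝ), IsOpen U ∧ Dense U ∧
      ∀ α β ρ : ℝ, (α, β, ρ) ∈ U → ∃ σ τ : ℝ,
        calE α β ρ * Real.cos σ = β * Real.cos ρ ∧
        calE α β ρ * Real.sin σ = α + β * Real.sin ρ ∧
        calF α β ρ * Real.cos τ = β * Real.cos ρ ∧
        calF α β ρ * Real.sin τ = α - β * Real.sin ρ ∧
        (bifSolSet 1 α β ρ σ τ).Finite ∧ (bifSolSet 1 α β ρ σ τ).Nonempty ∧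
        ∀ p ∈ bifSolSet 1 α β ρ σ τ, bifJac 1 α β ρ σ τ p.1 p.2.1 p.2.2 ≠ 0 := by
  set h : ℝ → ℝ × ℝ := fun e =>
    ((deriv (coefA 1) e + deriv (coefB 1) e) ^ 2 - (deriv (coefA 1) e - deriv (coefB 1) e) ^ 2,
    -((deriv (coefA 1) e + deriv (coefB 1) e) ^ 2 + (deriv (coefA 1) e - deriv (coefB 1) e) ^ 2))
    with hh
  set S : Set (ℝ × ℝ) := {(0, 1), (1, 1), (1, -1)} ∪ h '' {e | e ∈ Ioo (0:ℝ) 1 ∧ VV e = 0} with hS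
  have hfin : S.Finite := (Set.toFinite _).union (VV_finite.image _)
  have hne : ∀ c ∈ S, c.1 ≠ 0 ∨ c.2 ≠ 0 := by
    rintro c (hc | ⟨e, ⟨he, -⟩, rfl⟩)
    · simp only [mem_insert_iff, mem_singleton_iff] at hc
      rcases hc with rfl | rfl | rfl <;> simp
    · right
      simp only [hh]
      rw [(dcoefA he).deriv, (dcoefB he).deriv]
      have hs := Real.sqrt_pos.2 (one_sub_pos he)
      have : 0 < al e ^ 2 + (be e / Real.sqrt (1 - e ^ 2)) ^ 2 := by
        rcases al_or_be he with h | h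
        · positivity
        · have : be e / Real.sqrt (1 - e ^ 2) ≠ 0 := div_ne_zero h hs.ne'
          positivity
      nlinarith
  set D : ℝ × ℝ → Set (ℝ × ℝ × ℝ) := fun c =>
    {p | c.1 * (p.1 ^ 2 + p.2.1 ^ 2) + c.2 * (2 * p.1 * p.2.1 * Real.sin p.2.2) ≠ 0} with hD
  have hDo : ∀ c, IsOpen (D c) := by
    intro c
    apply isOpen_ne_fun <;> fun_prop
  refine ⟨⋂ c ∈ S, D c, hfin.isOpen_biInter fun c _ => hDo c,
    dense_biInter_of_isOpen (fun c _ => hDo c) hfin.countable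
      (fun c hc => dense_quad c.1 c.2 (hne c hc)), ?_⟩
  intro α β ρ hU
  rw [mem_iInter₂] at hU
  have u1 : (α, β, ρ) ∈ D (0, 1) := hU _ (by simp [hS])
  have u2 : (α, β, ρ) ∈ D (1, 1) := hU _ (by simp [hS])
  have u3 : (α, β, ρ) ∈ D (1, -1) := hU _ (by simp [hS])
  have u4 : ∀ e ∈ Ioo (0:ℝ) 1, VV e = 0 → (α, β, ρ) ∈ D (h e) :=
    fun e he hv => hU _ (Or.inr ⟨e, ⟨he, hv⟩, rfl⟩)
  simp only [hD, mem_ofPred_eq] at u1 u2 u3 u4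
  have sc := Real.sin_sq_add_cos_sq ρ
  have iE : α ^ 2 + β ^ 2 + 2 * α * β * Real.sin ρ
      = (β * Real.cos ρ) ^ 2 + (α + β * Real.sin ρ) ^ 2 := by
    linear_combination (-β ^ 2) * sc
  have iF : α ^ 2 + β ^ 2 - 2 * α * β * Real.sin ρ
      = (β * Real.cos ρ) ^ 2 + (α - β * Real.sin ρ) ^ 2 := by
    linear_combination (-β ^ 2) * sc
  have pE : 0 < α ^ 2 + β ^ 2 + 2 * α * β * Real.sin ρ := by
    refine lt_of_le_of_ne (by rw [iE]; positivity) (fun hh => u2 ?_)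
    linear_combination -hh
  have pF : 0 < α ^ 2 + β ^ 2 - 2 * α * β * Real.sin ρ := by
    refine lt_of_le_of_ne (by rw [iF]; positivity) (fun hh => u3 ?_)
    linear_combination -hh
  have hE : 0 < calE α β ρ := Real.sqrt_pos.2 pE
  have hF : 0 < calF α β ρ := Real.sqrt_pos.2 pF
  have sE : calE α β ρ ^ 2 = α ^ 2 + β ^ 2 + 2 * α * β * Real.sin ρ := Real.sq_sqrt pE.le
  have sF : calF α β ρ ^ 2 = α ^ 2 + β ^ 2 - 2 * α * β * Real.sin ρ := Real.sq_sqrt pF.le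
  obtain ⟨σ, hσ1, hσ2⟩ := angle_exists (β * Real.cos ρ) (α + β * Real.sin ρ) _ hE (by rw [sE, iE])
  obtain ⟨τ, hτ1, hτ2⟩ := angle_exists (β * Real.cos ρ) (α - β * Real.sin ρ) _ hF (by rw [sF, iF])
  refine ⟨σ, τ, hσ1, hσ2, hτ1, hτ2, sol_finite hE hF ?_, sol_nonempty hE hF, fun p hp =>
    sol_simple hE hF ?_ hp⟩
  · intro hEF
    apply u1
    rw [hEF] at sE
    linear_combination (1 / 2) * sF - (1 / 2) * sE
  · intro e he hv heq
    apply u4 e he hv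
    rw [sE, sF] at heq
    simp only [hh]
    linear_combination heq
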